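/- arXiv:2101.09055 — 7 statements merged into one kernel-verified Lean document; each statement's English description precedes it below -/
import Mathlib

section
/- Let V : ℝ → B(H) be a norm-continuous, 2π-periodic family of bounded operators on H. Then for every t ∈ ℝ one has U(t) ∘ ŴV(t) ∘ U(t)⁻¹ = ⟨V⟩; that is, for every ψ ∈ H, U(t)(ŴV(t)(U(t)⁻¹ψ)) = ⟨V⟩ψ. In particular ŴV(0) = ⟨V⟩ and the resonant average of the averaged family equals ⟨V⟩: for every ψ ∈ H, (1/2π) ∫₀^{2π} U(t)(ŴV(t)(U(t)⁻¹ψ)) dt = ⟨V⟩ψ. -/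
/- STATEMENT 0:
H = ℓ²(ℕ,ℂ), U(s) unitary diagonal with U(s) eₙ = e^{i s (n+λ)} eₙ, V : ℝ → B(H)
norm-continuous 2π-periodic.  Averaged operator ŴV(t)ψ = (1/2π)∫₀^{2π} U(s)(V(t+s)(U(s)⁻¹ψ)) ds,
resonant average ⟨V⟩ = ŴV(0).  Then U(t)∘ŴV(t)∘U(t)⁻¹ = ⟨V⟩ for all t, ŴV(0) = ⟨V⟩, and the
resonant average of the averaged family equals ⟨V⟩. -/

open MeasureTheory Real
open scoped InnerProductSpace

noncomputable section

/-- The Hilbert space ℓ²(ℕ, ℂ). -/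
abbrev H2 : Type := lp (fun _ : ℕ => ℂ) 2

/-- The standard orthonormal basis of ℓ²(ℕ, ℂ). -/
def e (n : ℕ) : H2 := lp.single 2 n 1

/-- The averaged operator `ŴV(t)`, as a map on vectors:
`ŴV(t)ψ = (1/2π) ∫₀^{2π} U(s)(V(t+s)(U(s)⁻¹ψ)) ds`. -/
def avg (U : ℝ → (H2 ≃ₗᵢ[ℂ] H2)) (V : ℝ → H2 →L[ℂ] H2) (t : ℝ) (ψ : H2) : H2 :=
  (1 / (2 * π) : ℝ) • ∫ s in (0:ℝ)..(2 * π), U s (V (t + s) ((U s).symm ψ))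

/-- The resonant average `⟨V⟩ := ŴV(0)`, as a map on vectors. -/
def resAvg (U : ℝ → (H2 ≃ₗᵢ[ℂ] H2)) (V : ℝ → H2 →L[ℂ] H2) (ψ : H2) : H2 :=
  avg U V 0 ψ

theorem clm_ext_basis {A B : H2 →L[ℂ] H2} (h : ∀ n, A (e n) = B (e n)) (x : H2) : A x = B x := by
  have hs := lp.hasSum_single (E := fun _ : ℕ => ℂ) (p := 2) (by norm_num) x
  have hA := hs.mapL A
  have hB := hs.mapL B
  refine hA.unique ?_
  convert hB using 2 with n
  have hx : lp.single (E := fun _ : ℕ => ℂ) 2 n (x n) = (x n) • e n := by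
    rw [e, ← lp.single_smul]
    simp
  rw [hx, map_smul, map_smul, h]

theorem U_mul {lam : ℝ} {U : ℝ → (H2 ≃ₗᵢ[ℂ] H2)}
    (hU : ∀ (s : ℝ) (n : ℕ), U s (e n) = Complex.exp (Complex.I * s * (n + lam)) • e n)
    (t s : ℝ) (x : H2) : U t (U s x) = U (t + s) x := by
  have := clm_ext_basis
    (A := ((U t : H2 ≃L[ℂ] H2) : H2 →L[ℂ] H2).comp ((U s : H2 ≃L[ℂ] H2) : H2 →L[ℂ] H2))
    (B := ((U (t + s) : H2 ≃L[ℂ] H2) : H2 →L[ℂ] H2)) ?_ x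
  · simpa using this
  · intro n
    simp only [ContinuousLinearMap.comp_apply, ContinuousLinearEquiv.coe_coe,
      LinearIsometryEquiv.coe_toContinuousLinearEquiv]
    rw [hU, map_smul, hU, hU, smul_smul, ← Complex.exp_add]
    congr 2
    push_cast
    ring

theorem U_two_pi {lam : ℝ} {U : ℝ → (H2 ≃ₗᵢ[ℂ] H2)}
    (hU : ∀ (s : ℝ) (n : ℕ), U s (e n) = Complex.exp (Complex.I * s * (n + lam)) • e n)
    (s : ℝ) (x : H2) :
    U (s + 2 * π) x = Complex.exp (Complex.I * (2 * π) * lam) • U s x := by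
  have := clm_ext_basis
    (A := ((U (s + 2 * π) : H2 ≃L[ℂ] H2) : H2 →L[ℂ] H2))
    (B := Complex.exp (Complex.I * (2 * π) * lam) • ((U s : H2 ≃L[ℂ] H2) : H2 →L[ℂ] H2)) ?_ x
  · simpa using this
  · intro n
    simp only [smul_apply, ContinuousLinearEquiv.coe_coe,
      LinearIsometryEquiv.coe_toContinuousLinearEquiv]
    rw [hU, hU, smul_smul, ← Complex.exp_add]
    congr 1
    rw [Complex.exp_eq_exp_iff_exists_int]
    refine ⟨n, ?_⟩
    push_cast
    ring

theorem conj_avg {lam : ℝ} {U : ℝ → (H2 ≃ₗᵢ[ℂ] H2)}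
    (hU : ∀ (s : ℝ) (n : ℕ), U s (e n) = Complex.exp (Complex.I * s * (n + lam)) • e n)
    (V : ℝ → H2 →L[ℂ] H2) (hVper : ∀ t, V (t + 2 * π) = V t) (t : ℝ) (ψ : H2) :
    U t (avg U V t ((U t).symm ψ)) = resAvg U V ψ := by
  have hsymm : ∀ s, (U s).symm ((U t).symm ψ) = (U (t + s)).symm ψ := by
    intro s
    apply (U (t + s)).injective
    rw [← U_mul hU]
    simp
  have hper : Function.Periodic (fun s => U s (V s ((U s).symm ψ))) (2 * π) := by
    intro s
    have h1 : (U s).symm ψ = Complex.exp (Complex.I * (2 * π) * lam) • (U (s + 2 * π)).symm ψ := by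
      apply (U s).injective
      rw [map_smul, ← U_two_pi hU]
      simp
    simp only
    rw [h1, hVper, map_smul, map_smul, U_two_pi hU]
  have hcomm : U t (∫ s in (0:ℝ)..(2 * π), U s (V (t + s) ((U s).symm ((U t).symm ψ))))
      = ∫ s in (0:ℝ)..(2 * π), U t (U s (V (t + s) ((U s).symm ((U t).symm ψ)))) := by
    rw [intervalIntegral.integral_of_le (by positivity),
      intervalIntegral.integral_of_le (by positivity)]
    exact ((U t : H2 ≃L[ℂ] H2).integral_comp_comm _).symm
  have hr : ∀ (r : ℝ) (x : H2), U t (r • x) = r • U t x := by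
    intro r x
    exact map_real_smul (U t) (U t).continuous r x
  unfold resAvg avg
  rw [hr, hcomm]
  congr 1
  simp only [U_mul hU, hsymm, zero_add]
  rw [intervalIntegral.integral_comp_add_left (fun s => U s (V s ((U s).symm ψ))) t]
  have := hper.intervalIntegral_add_eq t 0
  simpa using this

theorem stmt0 (lam : ℝ) (hlam : 0 ≤ lam)
    (U : ℝ → (H2 ≃ₗᵢ[ℂ] H2))
    (hU : ∀ (s : ℝ) (n : ℕ), U s (e n) = Complex.exp (Complex.I * s * (n + lam)) • e n)
    (V : ℝ → H2 →L[ℂ] H2)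
    (hVcont : Continuous V)
    (hVper : ∀ t, V (t + 2 * π) = V t) :
    (∀ (t : ℝ) (ψ : H2), U t (avg U V t ((U t).symm ψ)) = resAvg U V ψ) ∧
    (∀ ψ : H2, avg U V 0 ψ = resAvg U V ψ) ∧
    (∀ ψ : H2,
      (1 / (2 * π) : ℝ) • ∫ t in (0:ℝ)..(2 * π), U t (avg U V t ((U t).symm ψ))
        = resAvg U V ψ) := by
  refine ⟨conj_avg hU V hVper, fun _ => rfl, fun ψ => ?_⟩
  simp only [conj_avg hU V hVper, intervalIntegral.integral_const, sub_zero, smul_smul]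
  rw [one_div, inv_mul_cancel₀ (by positivity), one_smul]

end
end

section
/- Let V : ℝ → B(H) be a norm-continuous, 2π-periodic family of bounded operators on H, and define X(t) by X(t)ψ := ∫₀^t U(s−t)((V(s) − ŴV(s))(U(s−t)⁻¹ψ)) ds for ψ ∈ H. Then for every n, m ∈ ℕ the function t ↦ ⟨X(t)e_n, e_m⟩ is differentiable on ℝ and satisfies (d/dt)⟨X(t)e_n, e_m⟩ + i (m − n) ⟨X(t)e_n, e_m⟩ = ⟨(V(t) − ŴV(t)) e_n, e_m⟩; that is, X solves the homological equation ∂_t X + i[K₀, X] = V − ŴV in the sense of matrix elements, where K₀ is the diagonal operator K₀ e_n = (n+λ) e_n. -/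
/- STATEMENT 1:
With H = ℓ²(ℕ,ℂ), U(s) the diagonal unitary U(s)eₙ = e^{is(n+λ)}eₙ, V norm-continuous and
2π-periodic, ŴV the averaged family, and X(t)ψ := ∫₀^t U(s−t)((V(s) − ŴV(s))(U(s−t)⁻¹ψ)) ds,
the matrix elements t ↦ ⟨X(t)eₙ, eₘ⟩ are differentiable and satisfy
(d/dt)⟨X(t)eₙ,eₘ⟩ + i(m−n)⟨X(t)eₙ,eₘ⟩ = ⟨(V(t)−ŴV(t))eₙ,eₘ⟩,
i.e. X solves the homological equation ∂ₜX + i[K₀,X] = V − ŴV in matrix elements,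
where K₀ eₙ = (n+λ)eₙ.  (Matrix elements ⟨Xeₙ,eₘ⟩, linear in the first argument,
correspond to Mathlib's `⟪eₘ, X eₙ⟫_ℂ`.) -/

open MeasureTheory Real
open scoped InnerProductSpace

noncomputable section

/-- The solution `X(t)ψ = ∫₀^t U(s−t)((V(s) − ŴV(s))(U(s−t)⁻¹ψ)) ds` of the
homological equation. -/
def Xop (U : ℝ → (H2 ≃ₗᵢ[ℂ] H2)) (V : ℝ → H2 →L[ℂ] H2) (t : ℝ) (ψ : H2) : H2 :=
  ∫ s in (0:ℝ)..t,
    U (s - t) (V s ((U (s - t)).symm ψ) - avg U V s ((U (s - t)).symm ψ))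

lemma U_symm_e (lam : ℝ) (U : ℝ → (H2 ≃ₗᵢ[ℂ] H2))
    (hU : ∀ (s : ℝ) (n : ℕ), U s (e n) = Complex.exp (Complex.I * s * (n + lam)) • e n)
    (s : ℝ) (n : ℕ) :
    (U s).symm (e n) = Complex.exp (-(Complex.I * s * (n + lam))) • e n := by
  apply (U s).injective
  rw [LinearIsometryEquiv.apply_symm_apply, map_smul, hU, smul_smul, ← Complex.exp_add]
  simp

lemma dense_span_e : Dense ((Submodule.span ℂ (Set.range e) : Submodule ℂ H2) : Set H2) := by
  intro ψ
  have h := lp.hasSum_single (p := 2) (E := fun _ : ℕ => ℂ) (by simp) ψ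
  refine mem_closure_of_tendsto h (Filter.Eventually.of_forall fun S => ?_)
  refine Submodule.sum_mem _ fun i _ => ?_
  have : (lp.single 2 i (ψ i) : H2) = (ψ i) • e i := by
    rw [e, ← lp.single_smul]; simp
  rw [this]
  exact Submodule.smul_mem _ _ (Submodule.subset_span ⟨i, rfl⟩)

lemma U_cont (lam : ℝ) (U : ℝ → (H2 ≃ₗᵢ[ℂ] H2))
    (hU : ∀ (s : ℝ) (n : ℕ), U s (e n) = Complex.exp (Complex.I * s * (n + lam)) • e n) :
    Continuous (fun p : H2 × ℝ => U p.2 p.1) := by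
  refine continuous_prod_of_dense_continuous_lipschitzWith _ 1 dense_span_e ?_ ?_
  · intro a ha
    induction ha using Submodule.span_induction with
    | mem x hx =>
      obtain ⟨n, rfl⟩ := hx
      simp only [hU]
      fun_prop
    | zero => simpa using continuous_const
    | add x y _ _ hx hy => simp only [map_add]; exact hx.add hy
    | smul c x _ hx => simp only [map_smul]; exact hx.const_smul c
  · intro b
    exact (U b).lipschitz

lemma inner_U (lam : ℝ) (U : ℝ → (H2 ≃ₗᵢ[ℂ] H2))
    (hU : ∀ (s : ℝ) (n : ℕ), U s (e n) = Complex.exp (Complex.I * s * (n + lam)) • e n)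
    (s : ℝ) (m : ℕ) (φ : H2) :
    ⟪e m, U s φ⟫_ℂ = Complex.exp (Complex.I * s * (m + lam)) * ⟪e m, φ⟫_ℂ := by
  have h := (U s).inner_map_map ((U s).symm (e m)) φ
  rw [LinearIsometryEquiv.apply_symm_apply, U_symm_e lam U hU, inner_smul_left,
    ← Complex.exp_conj] at h
  rw [h]
  congr 2
  simp

lemma avg_smul (U : ℝ → (H2 ≃ₗᵢ[ℂ] H2)) (V : ℝ → H2 →L[ℂ] H2) (t : ℝ) (c : ℂ) (ψ : H2) :
    avg U V t (c • ψ) = c • avg U V t ψ := by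
  simp only [avg, map_smul]
  rw [intervalIntegral.integral_smul, smul_comm]

theorem stmt1 (lam : ℝ) (hlam : 0 ≤ lam)
    (U : ℝ → (H2 ≃ₗᵢ[ℂ] H2))
    (hU : ∀ (s : ℝ) (n : ℕ), U s (e n) = Complex.exp (Complex.I * s * (n + lam)) • e n)
    (V : ℝ → H2 →L[ℂ] H2)
    (hVcont : Continuous V)
    (hVper : ∀ t, V (t + 2 * π) = V t) :
    ∀ (n m : ℕ),
      Differentiable ℝ (fun t : ℝ => (⟪e m, Xop U V t (e n)⟫_ℂ : ℂ)) ∧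
      ∀ t : ℝ,
        deriv (fun τ : ℝ => (⟪e m, Xop U V τ (e n)⟫_ℂ : ℂ)) t
            + Complex.I * ((m : ℂ) - (n : ℂ)) * ⟪e m, Xop U V t (e n)⟫_ℂ
          = ⟪e m, V t (e n) - avg U V t (e n)⟫_ℂ := by
  intro n m
  have hUc := U_cont lam U hU
  have hVe : Continuous fun s => V s (e n) := by fun_prop
  have hA : Continuous fun s => avg U V s (e n) := by
    unfold avg
    refine Continuous.const_smul (M := ℝ) (α := H2) ?_ (1 / (2 * π))
    refine intervalIntegral.continuous_parametric_intervalIntegral_of_continuous' ?_ _ _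
    have : Continuous fun p : ℝ × ℝ => (V (p.1 + p.2) ((U p.2).symm (e n)), p.2) := by
      simp only [U_symm_e lam U hU]
      fun_prop
    exact hUc.comp this
  have hW : Continuous fun s => V s (e n) - avg U V s (e n) := hVe.sub hA
  set w : ℝ → ℂ := fun s => ⟪e m, V s (e n) - avg U V s (e n)⟫_ℂ with hw
  have hwc : Continuous w := continuous_const.inner hW
  have key : ∀ t : ℝ, ⟪e m, Xop U V t (e n)⟫_ℂ =
      Complex.exp (-(Complex.I * ((m : ℂ) - n) * t)) *
        ∫ s in (0:ℝ)..t, Complex.exp (Complex.I * ((m : ℂ) - n) * s) * w s := by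
    intro t
    have h1 : ∀ s : ℝ,
        U (s - t) (V s ((U (s - t)).symm (e n)) - avg U V s ((U (s - t)).symm (e n))) =
        Complex.exp (-(Complex.I * ((s - t : ℝ) : ℂ) * (n + lam))) •
          U (s - t) (V s (e n) - avg U V s (e n)) := by
      intro s
      rw [U_symm_e lam U hU, avg_smul, map_smul, ← smul_sub, map_smul]
    unfold Xop
    simp only [h1]
    have h2 : Continuous fun s : ℝ => Complex.exp (-(Complex.I * ((s - t : ℝ) : ℂ) * (n + lam))) •
          U (s - t) (V s (e n) - avg U V s (e n)) := by
      have h4 : Continuous fun s : ℝ =>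
          Complex.exp (-(Complex.I * ((s - t : ℝ) : ℂ) * (n + lam))) := by fun_prop
      refine h4.smul ?_
      exact hUc.comp (hW.prodMk (by fun_prop : Continuous fun s : ℝ => s - t))
    have h3 := (innerSL ℂ (e m)).intervalIntegral_comp_comm (h2.intervalIntegrable (μ := volume) 0 t)
    simp only [innerSL_apply_apply] at h3
    rw [← h3, ← intervalIntegral.integral_const_mul]
    refine intervalIntegral.integral_congr fun s _ => ?_
    beta_reduce
    rw [inner_smul_right, inner_U lam U hU, ← mul_assoc, ← mul_assoc, ← Complex.exp_add,
      ← Complex.exp_add]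
    congr 2
    push_cast
    ring
  have hd : ∀ t : ℝ, HasDerivAt (fun τ : ℝ => (⟪e m, Xop U V τ (e n)⟫_ℂ : ℂ))
      (w t - Complex.I * ((m : ℂ) - (n : ℂ)) * ⟪e m, Xop U V t (e n)⟫_ℂ) t := by
    intro t
    simp only [key]
    have hc : Continuous fun s : ℝ => Complex.exp (Complex.I * ((m : ℂ) - n) * s) * w s := by
      fun_prop
    have hF := hc.integral_hasStrictDerivAt 0 t |>.hasDerivAt
    have hE : HasDerivAt (fun τ : ℝ => Complex.exp (-(Complex.I * ((m : ℂ) - n) * τ)))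
        (Complex.exp (-(Complex.I * ((m : ℂ) - n) * t)) * (-(Complex.I * ((m : ℂ) - n) * 1))) t :=
      ((Complex.ofRealCLM.hasDerivAt (x := t)).const_mul _).neg.cexp
    refine (hE.mul hF).congr_deriv ?_
    have h0 : Complex.exp (-(Complex.I * ((m : ℂ) - n) * t)) *
        Complex.exp (Complex.I * ((m : ℂ) - n) * t) = 1 := by
      rw [← Complex.exp_add]; simp
    linear_combination (w t) * h0
  refine ⟨fun t => (hd t).differentiableAt, fun t => ?_⟩
  rw [(hd t).deriv]
  ring

end
end

section
/- Let V : ℝ → B(H) be a norm-continuous, 2π-periodic family of bounded operators on H, and define X(t) by X(t)ψ := ∫₀^t U(s−t)((V(s) − ŴV(s))(U(s−t)⁻¹ψ)) ds for ψ ∈ H. Then X is 2π-periodic: X(t+2π)ψ = X(t)ψ for every t ∈ ℝ and every ψ ∈ H. Moreover, if V(s) is selfadjoint for every s ∈ ℝ, then X(t) is selfadjoint for every t ∈ ℝ. -/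
/- STATEMENT 2:
With H = ℓ²(ℕ,ℂ), U(s) the diagonal unitary U(s)eₙ = e^{is(n+λ)}eₙ, V norm-continuous and
2π-periodic, ŴV the averaged family, and X(t)ψ := ∫₀^t U(s−t)((V(s) − ŴV(s))(U(s−t)⁻¹ψ)) ds,
X is 2π-periodic: X(t+2π)ψ = X(t)ψ.  Moreover, if each V(s) is selfadjoint then each X(t) is
selfadjoint (selfadjointness expressed via inner products: ⟨Tψ,φ⟩ = ⟨ψ,Tφ⟩ for all ψ, φ). -/

open MeasureTheory Real
open scoped InnerProductSpace

noncomputable section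

theorem aux_dense (S : Submodule ℂ H2) (hS : IsClosed (S : Set H2)) (he : ∀ n, e n ∈ S)
    (ψ : H2) : ψ ∈ S := by
  have h := lp.hasSum_single (E := fun _ : ℕ => ℂ) (p := 2) (by norm_num) ψ
  refine hS.mem_of_tendsto h (Filter.Eventually.of_forall fun F => ?_)
  refine S.sum_mem fun i _ => ?_
  have : lp.single 2 i (ψ i) = (ψ i : ℂ) • e i := by
    rw [e, ← lp.single_smul]; simp
  rw [this]
  exact S.smul_mem _ (he i)

theorem aux_ext (f g : H2 →L[ℂ] H2) (h : ∀ n, f (e n) = g (e n)) (ψ : H2) : f ψ = g ψ := by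
  have := aux_dense (LinearMap.ker ((f - g : H2 →L[ℂ] H2) : H2 →ₗ[ℂ] H2))
    (f - g).isClosed_ker (fun n => by simp [h]) ψ
  simpa [sub_eq_zero] using this

theorem aux_cont (U : ℝ → (H2 ≃ₗᵢ[ℂ] H2)) (h : ∀ n, Continuous fun s => U s (e n)) (ψ : H2) :
    Continuous fun s => U s ψ := by
  let S : Submodule ℂ H2 :=
    { carrier := {ψ | Continuous fun s => U s ψ}
      add_mem' := by
        intro a b ha hb
        simp only [Set.mem_ofPred_eq, map_add] at *
        exact ha.add hb
      zero_mem' := by simp [continuous_const]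
      smul_mem' := by
        intro c a ha
        simp only [Set.mem_ofPred_eq, map_smul] at *
        exact ha.const_smul c }
  refine aux_dense S ?_ h ψ
  refine isClosed_of_closure_subset fun φ hφ => ?_
  change Continuous fun s => U s φ
  refine continuous_of_uniform_approx_of_continuous fun u hu => ?_
  obtain ⟨ε, hε, hu⟩ := Metric.mem_uniformity_dist.1 hu
  obtain ⟨b, hb, hd⟩ := Metric.mem_closure_iff.1 hφ ε hε
  exact ⟨fun s => U s b, hb, fun s => hu (by rwa [(U s).dist_map])⟩

theorem aux_cont2 (U : ℝ → (H2 ≃ₗᵢ[ℂ] H2)) (h : ∀ ψ, Continuous fun s => U s ψ)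
    (f : ℝ → H2) (hf : Continuous f) : Continuous fun s => U s (f s) := by
  rw [continuous_iff_continuousAt]
  intro s₀
  rw [ContinuousAt, tendsto_iff_dist_tendsto_zero]
  have h1 : Filter.Tendsto (fun s => dist (f s) (f s₀) + dist (U s (f s₀)) (U s₀ (f s₀)))
      (nhds s₀) (nhds 0) := by
    have a := tendsto_iff_dist_tendsto_zero.1 (hf.tendsto s₀)
    have b := tendsto_iff_dist_tendsto_zero.1 ((h (f s₀)).tendsto s₀)
    simpa using a.add b
  refine squeeze_zero (fun _ => dist_nonneg) (fun s => ?_) h1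
  calc _ ≤ dist (U s (f s)) (U s (f s₀)) + dist (U s (f s₀)) (U s₀ (f s₀)) := dist_triangle _ _ _
    _ = _ := by rw [(U s).dist_map]

/-- The conjugated family. -/
def GG (U : ℝ → (H2 ≃ₗᵢ[ℂ] H2)) (V : ℝ → H2 →L[ℂ] H2) (r : ℝ) (ψ : H2) : H2 :=
  U r (V r (U (-r) ψ))

/-- The averaged conjugated operator. -/
def AA (U : ℝ → (H2 ≃ₗᵢ[ℂ] H2)) (V : ℝ → H2 →L[ℂ] H2) (ψ : H2) : H2 :=
  (1 / (2 * π) : ℝ) • ∫ s in (0:ℝ)..(2 * π), GG U V s ψ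

theorem aux_add (lam : ℝ) (U : ℝ → (H2 ≃ₗᵢ[ℂ] H2))
    (hU : ∀ (s : ℝ) (n : ℕ), U s (e n) = Complex.exp (Complex.I * s * (n + lam)) • e n) (a b : ℝ) (ψ : H2) : U (a + b) ψ = U a (U b ψ) := by
  have := aux_ext ((U (a + b)).toContinuousLinearEquiv : H2 →L[ℂ] H2)
    (((U a).toContinuousLinearEquiv : H2 →L[ℂ] H2).comp
      ((U b).toContinuousLinearEquiv : H2 →L[ℂ] H2)) (fun n => by
      simp only [ContinuousLinearMap.comp_apply, ContinuousLinearEquiv.coe_coe,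
        LinearIsometryEquiv.coe_toContinuousLinearEquiv, hU, map_smul, smul_smul]
      rw [← Complex.exp_add]
      congr 2
      push_cast
      ring) ψ
  simpa using this

theorem aux_zero (lam : ℝ) (U : ℝ → (H2 ≃ₗᵢ[ℂ] H2))
    (hU : ∀ (s : ℝ) (n : ℕ), U s (e n) = Complex.exp (Complex.I * s * (n + lam)) • e n) (ψ : H2) : U 0 ψ = ψ := by
  have := aux_ext ((U 0).toContinuousLinearEquiv : H2 →L[ℂ] H2)
    (ContinuousLinearMap.id ℂ H2) (fun n => by simp [hU]) ψ
  simpa using this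

theorem aux_symm (lam : ℝ) (U : ℝ → (H2 ≃ₗᵢ[ℂ] H2))
    (hU : ∀ (s : ℝ) (n : ℕ), U s (e n) = Complex.exp (Complex.I * s * (n + lam)) • e n) (a : ℝ) (ψ : H2) : (U a).symm ψ = U (-a) ψ := by
  rw [LinearIsometryEquiv.symm_apply_eq, ← aux_add lam U hU, add_neg_cancel, aux_zero lam U hU]

theorem aux_two_pi (lam : ℝ) (U : ℝ → (H2 ≃ₗᵢ[ℂ] H2))
    (hU : ∀ (s : ℝ) (n : ℕ), U s (e n) = Complex.exp (Complex.I * s * (n + lam)) • e n) (ψ : H2) :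
    U (2 * π) ψ = Complex.exp (Complex.I * (2 * π) * lam) • ψ := by
  have := aux_ext ((U (2 * π)).toContinuousLinearEquiv : H2 →L[ℂ] H2)
    (Complex.exp (Complex.I * (2 * π) * lam) • ContinuousLinearMap.id ℂ H2) (fun n => by
      simp only [ContinuousLinearEquiv.coe_coe, ContinuousLinearMap.smul_apply,
        ContinuousLinearMap.id_apply,
        LinearIsometryEquiv.coe_toContinuousLinearEquiv, hU]
      congr 1
      rw [mul_add, Complex.exp_add]
      have : Complex.exp (Complex.I * ((2 * π : ℝ) : ℂ) * n) = 1 := by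
        rw [← Complex.exp_nat_mul_two_pi_mul_I n]
        congr 1
        push_cast
        ring
      rw [this, one_mul]
      push_cast
      rfl) ψ
  simpa using this

theorem aux_UV (lam : ℝ) (U : ℝ → (H2 ≃ₗᵢ[ℂ] H2))
    (hU : ∀ (s : ℝ) (n : ℕ), U s (e n) = Complex.exp (Complex.I * s * (n + lam)) • e n) (A : H2 →L[ℂ] H2) (ψ : H2) :
    U (2 * π) (A (U (-(2 * π)) ψ)) = A ψ := by
  rw [aux_two_pi lam U hU, ← map_smul, ← aux_two_pi lam U hU, ← aux_add lam U hU, add_neg_cancel,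
    aux_zero lam U hU]

theorem GG_per (lam : ℝ) (U : ℝ → (H2 ≃ₗᵢ[ℂ] H2))
    (hU : ∀ (s : ℝ) (n : ℕ), U s (e n) = Complex.exp (Complex.I * s * (n + lam)) • e n)
    (V : ℝ → H2 →L[ℂ] H2) (hVper : ∀ t, V (t + 2 * π) = V t) (ψ : H2) :
    Function.Periodic (fun r => GG U V r ψ) (2 * π) := by
  intro r
  simp only [GG]
  rw [hVper, aux_add lam U hU, neg_add_rev, aux_add lam U hU (-(2 * π)) (-r), aux_UV lam U hU]

theorem GG_cont (lam : ℝ) (U : ℝ → (H2 ≃ₗᵢ[ℂ] H2))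
    (hU : ∀ (s : ℝ) (n : ℕ), U s (e n) = Complex.exp (Complex.I * s * (n + lam)) • e n)
    (V : ℝ → H2 →L[ℂ] H2) (hVcont : Continuous V) (ψ : H2) :
    Continuous (fun r => GG U V r ψ) := by
  have hc : ∀ ψ, Continuous fun s => U s ψ := aux_cont U fun n => by
    simp only [hU]
    fun_prop
  refine aux_cont2 U hc _ (hVcont.clm_apply ((hc ψ).comp continuous_neg))

theorem avg_eq (lam : ℝ) (U : ℝ → (H2 ≃ₗᵢ[ℂ] H2))
    (hU : ∀ (s : ℝ) (n : ℕ), U s (e n) = Complex.exp (Complex.I * s * (n + lam)) • e n)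
    (V : ℝ → H2 →L[ℂ] H2) (hVper : ∀ t, V (t + 2 * π) = V t) (t : ℝ) (ψ : H2) :
    avg U V t ψ = U (-t) (AA U V (U t ψ)) := by
  have h1 : ∀ s, U s (V (t + s) ((U s).symm ψ)) = U (-t) (GG U V (t + s) (U t ψ)) := by
    intro s
    rw [GG, aux_symm lam U hU, ← aux_add lam U hU, ← aux_add lam U hU]
    congr 3 <;> ring_nf
  have h2 : ∀ f : ℝ → H2, ∫ s in (0:ℝ)..(2 * π), U (-t) (f s)
      = U (-t) (∫ s in (0:ℝ)..(2 * π), f s) := fun f => by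
    rw [intervalIntegral.integral_of_le (by positivity),
      intervalIntegral.integral_of_le (by positivity)]
    exact (U (-t)).toContinuousLinearEquiv.integral_comp_comm f
  have h3 := (GG_per lam U hU V hVper (U t ψ)).intervalIntegral_add_eq t 0
  have h4 : ∀ (c : ℝ) (x : H2), U (-t) (c • x) = c • U (-t) x := fun c x => by
    exact map_real_smul (U (-t)) (U (-t)).continuous c x
  simp only [avg, AA, h1]
  rw [h2, h4, intervalIntegral.integral_comp_add_left (fun s => GG U V s (U t ψ)), add_zero, h3,
    zero_add]

theorem Xop_eq (lam : ℝ) (U : ℝ → (H2 ≃ₗᵢ[ℂ] H2))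
    (hU : ∀ (s : ℝ) (n : ℕ), U s (e n) = Complex.exp (Complex.I * s * (n + lam)) • e n)
    (V : ℝ → H2 →L[ℂ] H2) (hVper : ∀ t, V (t + 2 * π) = V t) (t : ℝ) (ψ : H2) :
    Xop U V t ψ = U (-t) (∫ s in (0:ℝ)..t, (GG U V s (U t ψ) - AA U V (U t ψ))) := by
  have h1 : ∀ s, U (s - t) (V s ((U (s - t)).symm ψ) - avg U V s ((U (s - t)).symm ψ))
      = U (-t) (GG U V s (U t ψ) - AA U V (U t ψ)) := by
    intro s
    rw [avg_eq lam U hU V hVper, aux_symm lam U hU, GG, map_sub, map_sub]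
    simp only [← aux_add lam U hU]
    have e1 : s - t = -t + s := by ring
    have e2 : s + -(-t + s) = t := by ring
    have e3 : -(-t + s) = -s + t := by ring
    have e4 : -t + s + -s = -t := by ring
    rw [e1, e2, e3, e4]
  simp only [Xop, h1]
  have := (U (-t)).toContinuousLinearEquiv.toContinuousLinearMap
  simp only [intervalIntegral]
  rw [map_sub]
  congr 1
  · exact (U (-t)).toContinuousLinearEquiv.integral_comp_comm _
  · exact (U (-t)).toContinuousLinearEquiv.integral_comp_comm _

theorem U_adj (lam : ℝ) (U : ℝ → (H2 ≃ₗᵢ[ℂ] H2))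
    (hU : ∀ (s : ℝ) (n : ℕ), U s (e n) = Complex.exp (Complex.I * s * (n + lam)) • e n) (a : ℝ) (ψ φ : H2) : ⟪U a ψ, φ⟫_ℂ = ⟪ψ, U (-a) φ⟫_ℂ := by
  rw [← aux_symm lam U hU, ← (U a).inner_map_map ψ, LinearIsometryEquiv.apply_symm_apply]

theorem GG_adj (lam : ℝ) (U : ℝ → (H2 ≃ₗᵢ[ℂ] H2))
    (hU : ∀ (s : ℝ) (n : ℕ), U s (e n) = Complex.exp (Complex.I * s * (n + lam)) • e n)
    (V : ℝ → H2 →L[ℂ] H2) (hV : ∀ (s : ℝ) (ψ φ : H2), ⟪V s ψ, φ⟫_ℂ = ⟪ψ, V s φ⟫_ℂ)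
    (r : ℝ) (ψ φ : H2) : ⟪GG U V r ψ, φ⟫_ℂ = ⟪ψ, GG U V r φ⟫_ℂ := by
  simp only [GG]
  rw [U_adj lam U hU, hV, U_adj lam U hU, neg_neg]

theorem int_adj (f g : ℝ → H2) (hf : Continuous f) (hg : Continuous g) (ψ φ : H2)
    (h : ∀ s, ⟪f s, φ⟫_ℂ = ⟪ψ, g s⟫_ℂ) (a b : ℝ) :
    ⟪∫ s in a..b, f s, φ⟫_ℂ = ⟪ψ, ∫ s in a..b, g s⟫_ℂ := by
  have h1 : ∀ (f : ℝ → H2) (_ : Continuous f) (φ : H2),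
      ⟪φ, ∫ s in a..b, f s⟫_ℂ = ∫ s in a..b, ⟪φ, f s⟫_ℂ := fun f hf φ =>
    ((innerSL ℂ φ).intervalIntegral_comp_comm (hf.intervalIntegrable a b)).symm
  rw [← inner_conj_symm, h1 f hf, h1 g hg]
  simp only [intervalIntegral, map_sub, ← integral_conj, inner_conj_symm, h]

theorem AA_adj (lam : ℝ) (U : ℝ → (H2 ≃ₗᵢ[ℂ] H2))
    (hU : ∀ (s : ℝ) (n : ℕ), U s (e n) = Complex.exp (Complex.I * s * (n + lam)) • e n)
    (V : ℝ → H2 →L[ℂ] H2) (hVcont : Continuous V)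
    (hV : ∀ (s : ℝ) (ψ φ : H2), ⟪V s ψ, φ⟫_ℂ = ⟪ψ, V s φ⟫_ℂ)
    (ψ φ : H2) : ⟪AA U V ψ, φ⟫_ℂ = ⟪ψ, AA U V φ⟫_ℂ := by
  have := int_adj _ _ (GG_cont lam U hU V hVcont ψ) (GG_cont lam U hU V hVcont φ) ψ φ
    (fun s => GG_adj lam U hU V hV s ψ φ) 0 (2 * π)
  simp only [AA]
  have hs : ∀ (c : ℝ) (x : H2), c • x = (c : ℂ) • x := by
    intro c x
    first
    | rfl
    | exact (Complex.coe_smul c x).symm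
    | (ext n; change c • x n = (c : ℂ) • x n; simp)
  rw [hs, hs, inner_smul_left, inner_smul_right, this,
    Complex.conj_ofReal]

theorem stmt2 (lam : ℝ) (hlam : 0 ≤ lam)
    (U : ℝ → (H2 ≃ₗᵢ[ℂ] H2))
    (hU : ∀ (s : ℝ) (n : ℕ), U s (e n) = Complex.exp (Complex.I * s * (n + lam)) • e n)
    (V : ℝ → H2 →L[ℂ] H2)
    (hVcont : Continuous V)
    (hVper : ∀ t, V (t + 2 * π) = V t) :
    (∀ (t : ℝ) (ψ : H2), Xop U V (t + 2 * π) ψ = Xop U V t ψ) ∧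
    ((∀ (s : ℝ) (ψ φ : H2), ⟪V s ψ, φ⟫_ℂ = ⟪ψ, V s φ⟫_ℂ) →
      ∀ (t : ℝ) (ψ φ : H2), ⟪Xop U V t ψ, φ⟫_ℂ = ⟪ψ, Xop U V t φ⟫_ℂ) := by
  refine ⟨fun t ψ => ?_, fun hV t ψ φ => ?_⟩
  · rw [Xop_eq lam U hU V hVper, Xop_eq lam U hU V hVper]
    set F : H2 → H2 := fun χ => ∫ s in (0:ℝ)..t, (GG U V s χ - AA U V χ) with hF
    have hc := GG_cont lam U hU V hVcont
    have h1 : ∀ χ : H2, ∫ s in (0:ℝ)..(t + 2 * π), (GG U V s χ - AA U V χ) = F χ := by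
      intro χ
      have hi : Continuous fun s => GG U V s χ - AA U V χ := (hc χ).sub continuous_const
      rw [← intervalIntegral.integral_add_adjacent_intervals (b := t)
        (hi.intervalIntegrable _ _) (hi.intervalIntegrable _ _)]
      rw [hF, add_eq_left, intervalIntegral.integral_sub ((hc χ).intervalIntegrable _ _)
        (continuous_const.intervalIntegrable _ _), intervalIntegral.integral_const,
        (GG_per lam U hU V hVper χ).intervalIntegral_add_eq t 0, AA, smul_smul, zero_add,
        add_sub_cancel_left, mul_one_div_cancel (by positivity), one_smul, sub_self]
    have hG : ∀ (s : ℝ) (c : ℂ) (χ : H2), GG U V s (c • χ) = c • GG U V s χ := by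
      intro s c χ
      simp [GG]
    have hA : ∀ (c : ℂ) (χ : H2), AA U V (c • χ) = c • AA U V χ := by
      intro c χ
      simp only [AA, hG]
      rw [intervalIntegral.integral_smul, smul_comm]
    have h2 : ∀ (c : ℂ) (χ : H2), F (c • χ) = c • F χ := by
      intro c χ
      simp only [hF, hG, hA, ← smul_sub]
      rw [intervalIntegral.integral_smul]
    rw [h1, add_comm t, aux_add lam U hU, aux_two_pi lam U hU, h2, ← aux_two_pi lam U hU,
      ← aux_add lam U hU]
    congr 2
    ring
  · rw [Xop_eq lam U hU V hVper, Xop_eq lam U hU V hVper, U_adj lam U hU, neg_neg]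
    have hc := GG_cont lam U hU V hVcont
    rw [int_adj (fun s => GG U V s (U t ψ) - AA U V (U t ψ))
      (fun s => GG U V s (U t φ) - AA U V (U t φ)) ((hc _).sub continuous_const)
      ((hc _).sub continuous_const) (U t ψ) (U t φ) (fun s => ?_) 0 t, U_adj lam U hU]
    rw [inner_sub_left, inner_sub_right, GG_adj lam U hU V hV, AA_adj lam U hU V hVcont hV]

end
end

section
/- Let 𝔙 be a bounded selfadjoint Töplitz operator on H, let k ∈ ℕ with k ≥ 1, and set 𝔙_k := ⟨𝔙 e_0, e_k⟩. Then for every ψ ∈ H, (1/2π) ∫₀^{2π} cos(k s) · U(s)(𝔙(U(s)⁻¹ψ)) ds = (1/2)(𝔙_k S^k ψ + conj(𝔙_k) (S*)^k ψ), where the integral is a vector-valued Bochner integral. -/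
/- STATEMENT 3:
H = ℓ²(ℕ,ℂ), U(s) the diagonal unitary U(s)eₙ = e^{is(n+λ)}eₙ, S the right shift
(S eₙ = eₙ₊₁) with adjoint S* (S* e₀ = 0, S* eₙ₊₁ = eₙ).  If 𝔙 is a bounded selfadjoint
Töplitz operator (its matrix elements ⟨𝔙eₙ, eₘ⟩ depend only on m − n), k ≥ 1 and
𝔙ₖ := ⟨𝔙e₀, eₖ⟩, then for every ψ,
(1/2π) ∫₀^{2π} cos(ks) · U(s)(𝔙(U(s)⁻¹ψ)) ds = (1/2)(𝔙ₖ Sᵏψ + conj(𝔙ₖ) (S*)ᵏψ).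
(Matrix elements, linear in the first argument, correspond to Mathlib's ⟪eₘ, 𝔙 eₙ⟫_ℂ.) -/

open MeasureTheory Real
open scoped InnerProductSpace

noncomputable section

theorem real_smul_H2 (r : ℝ) (x : H2) : r • x = (r : ℂ) • x := by
  rfl

theorem inner_e (m : ℕ) (x : H2) : (⟪e m, x⟫_ℂ : ℂ) = x m := by
  simp [e, lp.inner_single_left]

theorem inner_e_e (m n : ℕ) : (⟪e m, e n⟫_ℂ : ℂ) = if m = n then 1 else 0 := by
  rw [inner_e, e, lp.single_apply, Pi.single_apply]

theorem hasSum_e (x : H2) : HasSum (fun i => x i • e i) x := by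
  have h := lp.hasSum_single (E := fun _ : ℕ => ℂ) (p := 2) (by norm_num) x
  refine h.congr_fun ?_ |> id
  intro i
  rw [e, ← lp.single_smul, smul_eq_mul, mul_one]

theorem dense_e : Dense (Submodule.span ℂ (Set.range e) : Set H2) := by
  intro x
  refine mem_closure_of_tendsto (hasSum_e x) (Filter.Eventually.of_forall fun t => ?_)
  exact Submodule.sum_mem _ fun i _ => Submodule.smul_mem _ _ (Submodule.subset_span ⟨i, rfl⟩)

theorem cont_strong (W : ℝ → (H2 ≃ₗᵢ[ℂ] H2)) (c : ℕ → ℝ → ℂ) (hc : ∀ n, Continuous (c n))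
    (hW : ∀ s n, W s (e n) = c n s • e n) (x : H2) : Continuous fun s => W s x := by
  refine continuous_of_uniform_approx_of_continuous fun u hu => ?_
  obtain ⟨ε, hε, hu⟩ := Metric.mem_uniformity_dist.1 hu
  obtain ⟨y, hy, hxy⟩ := Metric.mem_closure_iff.1 (dense_e x) ε hε
  refine ⟨fun s => W s y, ?_, fun s => hu ?_⟩
  · clear hxy
    induction hy using Submodule.span_induction with
    | mem z hz =>
      obtain ⟨n, rfl⟩ := hz
      simp only [hW]
      exact (hc n).smul continuous_const
    | zero => simpa using continuous_const
    | add a b _ _ ha hb => simp only [map_add]; exact ha.add hb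
    | smul r a _ ha => simp only [map_smul]; exact ha.const_smul r
  · simpa using hxy

theorem cont_comp (W : ℝ → (H2 ≃ₗᵢ[ℂ] H2)) (hW : ∀ x, Continuous fun s => W s x)
    (g : ℝ → H2) (hg : Continuous g) : Continuous fun s => W s (g s) := by
  rw [continuous_iff_continuousAt]
  intro t
  rw [ContinuousAt, tendsto_iff_dist_tendsto_zero]
  have h1 := tendsto_iff_dist_tendsto_zero.1 (hg.tendsto t)
  have h2 := tendsto_iff_dist_tendsto_zero.1 ((hW (g t)).tendsto t)
  have h3 := h1.add h2
  rw [add_zero] at h3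
  refine squeeze_zero (fun _ => dist_nonneg) (fun s => ?_) h3
  calc dist (W s (g s)) (W t (g t))
      ≤ dist (W s (g s)) (W s (g t)) + dist (W s (g t)) (W t (g t)) := dist_triangle _ _ _
    _ = _ := by rw [(W s).dist_map]

theorem int_exp (j : ℤ) : ∫ s in (0:ℝ)..(2 * π), Complex.exp (Complex.I * j * s)
    = if j = 0 then 2 * π else 0 := by
  split_ifs with h
  · simp [h]
  · have hj : Complex.I * (j : ℂ) ≠ 0 := mul_ne_zero Complex.I_ne_zero (by exact_mod_cast h)
    rw [integral_exp_mul_complex hj]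
    have : Complex.exp (Complex.I * j * ((2 * π : ℝ) : ℂ)) = 1 := by
      rw [Complex.exp_eq_one_iff]
      exact ⟨j, by push_cast; ring⟩
    rw [this]; simp

theorem int_cos_exp (k : ℕ) (j : ℤ) :
    ∫ s in (0:ℝ)..(2 * π), (Real.cos (k * s) : ℂ) * Complex.exp (Complex.I * j * s)
    = (if j = -k then (π : ℂ) else 0) + (if j = k then (π : ℂ) else 0) := by
  have h : ∀ s : ℝ, (Real.cos (k * s) : ℂ) * Complex.exp (Complex.I * j * s)
      = (1/2 : ℂ) * Complex.exp (Complex.I * ((j + k : ℤ) : ℂ) * s)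
        + (1/2 : ℂ) * Complex.exp (Complex.I * ((j - k : ℤ) : ℂ) * s) := by
    intro s
    rw [Complex.ofReal_cos, Complex.cos]
    have e1 : Complex.I * ((j + k : ℤ) : ℂ) * s
      = ((k * s : ℝ) : ℂ) * Complex.I + Complex.I * j * s := by push_cast; ring
    have e2 : Complex.I * ((j - k : ℤ) : ℂ) * s
      = -((k * s : ℝ) : ℂ) * Complex.I + Complex.I * j * s := by push_cast; ring
    rw [e1, e2, Complex.exp_add, Complex.exp_add]
    ring
  simp_rw [h]
  rw [intervalIntegral.integral_add, intervalIntegral.integral_const_mul,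
    intervalIntegral.integral_const_mul, int_exp, int_exp]
  · have a1 : j + k = 0 ↔ j = -k := by omega
    have a2 : j - k = 0 ↔ j = k := by omega
    simp only [a1, a2]
    split_ifs <;> push_cast <;> ring
  · exact Continuous.intervalIntegrable (by fun_prop) _ _
  · exact Continuous.intervalIntegrable (by fun_prop) _ _

theorem stmt3 (lam : ℝ) (hlam : 0 ≤ lam)
    (U : ℝ → (H2 ≃ₗᵢ[ℂ] H2))
    (hU : ∀ (s : ℝ) (n : ℕ), U s (e n) = Complex.exp (Complex.I * s * (n + lam)) • e n)
    (S Sstar : H2 →L[ℂ] H2)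
    (hS : ∀ n : ℕ, S (e n) = e (n + 1))
    (hSstar0 : Sstar (e 0) = 0)
    (hSstar : ∀ n : ℕ, Sstar (e (n + 1)) = e n)
    (𝔙 : H2 →L[ℂ] H2)
    (h𝔙sa : ∀ ψ φ : H2, ⟪𝔙 ψ, φ⟫_ℂ = ⟪ψ, 𝔙 φ⟫_ℂ)
    (h𝔙top : ∀ n m n' m' : ℕ, (m : ℤ) - (n : ℤ) = (m' : ℤ) - (n' : ℤ) →
      (⟪e m, 𝔙 (e n)⟫_ℂ : ℂ) = ⟪e m', 𝔙 (e n')⟫_ℂ)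
    (k : ℕ) (hk : 1 ≤ k) :
    ∀ ψ : H2,
      (1 / (2 * π) : ℝ) • ∫ s in (0:ℝ)..(2 * π), Real.cos (k * s) • U s (𝔙 ((U s).symm ψ))
        = (1 / 2 : ℂ) • ((⟪e k, 𝔙 (e 0)⟫_ℂ : ℂ) • (S ^ k) ψ
            + (starRingEnd ℂ (⟪e k, 𝔙 (e 0)⟫_ℂ : ℂ)) • (Sstar ^ k) ψ) := by
  have hUs : ∀ (s : ℝ) (n : ℕ), (U s).symm (e n)
      = Complex.exp (-(Complex.I * s * (n + lam))) • e n := by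
    intro s n
    rw [LinearIsometryEquiv.symm_apply_eq, map_smul, hU, smul_smul, ← Complex.exp_add]
    simp
  have cU := cont_strong U (fun n s => Complex.exp (Complex.I * s * (n + lam)))
    (fun n => by fun_prop) hU
  have cUs := cont_strong (fun s => (U s).symm)
    (fun n s => Complex.exp (-(Complex.I * s * (n + lam)))) (fun n => by fun_prop) hUs
  have cF : ∀ ψ : H2, Continuous fun s : ℝ => Real.cos (k * s) • U s (𝔙 ((U s).symm ψ)) := by
    intro ψ
    exact (by fun_prop : Continuous fun s : ℝ => Real.cos (k * s)).smul
      (cont_comp U cU _ (𝔙.continuous.comp (cUs ψ)))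
  have iF := fun ψ => (cF ψ).intervalIntegrable (μ := volume) 0 (2 * π)
  let L : H2 →ₗ[ℂ] H2 :=
    { toFun := fun ψ => ∫ s in (0:ℝ)..(2 * π), Real.cos (k * s) • U s (𝔙 ((U s).symm ψ))
      map_add' := fun a b => by
        rw [← intervalIntegral.integral_add (iF a) (iF b)]
        simp only [map_add, smul_add]
      map_smul' := fun r a => by
        rw [RingHom.id_apply, ← intervalIntegral.integral_smul]
        simp only [map_smul]
        simp only [smul_comm r] }
  have hL : ∀ ψ, ‖L ψ‖ ≤ (‖𝔙‖ * |2 * π - 0|) * ‖ψ‖ := by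
    intro ψ
    have := intervalIntegral.norm_integral_le_of_norm_le_const (a := (0:ℝ)) (b := 2 * π)
      (f := fun s : ℝ => Real.cos (k * s) • U s (𝔙 ((U s).symm ψ))) (C := ‖𝔙‖ * ‖ψ‖)
      (fun s _ => by
        rw [norm_smul, LinearIsometryEquiv.norm_map]
        have h1 : ‖Real.cos (k * s)‖ ≤ 1 := Real.abs_cos_le_one _
        have h2 := 𝔙.le_opNorm ((U s).symm ψ)
        rw [LinearIsometryEquiv.norm_map] at h2
        calc _ ≤ 1 * (‖𝔙‖ * ‖ψ‖) := by gcongr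
          _ = _ := one_mul _)
    calc ‖L ψ‖ ≤ _ := this
      _ = _ := by ring
  let Lc : H2 →L[ℂ] H2 := L.mkContinuous _ hL
  have hSk : ∀ n, (S ^ k) (e n) = e (n + k) := by
    clear hk cF iF L hL Lc
    induction k with
    | zero => intro n; simp
    | succ k ih => intro n; rw [pow_succ', mul_apply_eq_comp, ih, hS, add_assoc]
  have hSsk : ∀ n, (Sstar ^ k) (e n) = if k ≤ n then e (n - k) else 0 := by
    clear hk cF iF L hL Lc hSk
    induction k with
    | zero => intro n; simp
    | succ k ih =>
      intro n
      rw [pow_succ, mul_apply_eq_comp]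
      cases n with
      | zero => simp [hSstar0]
      | succ n => rw [hSstar, ih]; simp
  let R : H2 →L[ℂ] H2 := (1 / 2 : ℂ) • ((⟪e k, 𝔙 (e 0)⟫_ℂ : ℂ) • (S ^ k)
            + (starRingEnd ℂ (⟪e k, 𝔙 (e 0)⟫_ℂ : ℂ)) • (Sstar ^ k))
  have key : ((1 / (2 * π) : ℝ) : ℂ) • Lc = R := by
    refine ContinuousLinearMap.ext_on dense_e ?_
    rintro _ ⟨n, rfl⟩
    refine lp.ext (funext fun m => ?_)
    rw [← inner_e, ← inner_e]
    have hl : (⟪e m, Lc (e n)⟫_ℂ : ℂ)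
        = ((if (m - n : ℤ) = -k then (π : ℂ) else 0) + (if (m - n : ℤ) = k then (π : ℂ) else 0))
          * ⟪e m, 𝔙 (e n)⟫_ℂ := by
      change innerSL ℂ (e m) (∫ s in (0:ℝ)..(2 * π), Real.cos (k * s) • U s (𝔙 ((U s).symm (e n))))
        = _
      rw [← ContinuousLinearMap.intervalIntegral_comp_comm _ (iF (e n)), ← int_cos_exp,
        ← intervalIntegral.integral_mul_const]
      refine intervalIntegral.integral_congr fun s _ => ?_
      simp only [innerSL_apply_apply]
      rw [real_smul_H2, inner_smul_right, hUs, map_smul, map_smul, inner_smul_right]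
      have : (⟪e m, U s (𝔙 (e n))⟫_ℂ : ℂ)
          = Complex.exp (Complex.I * s * (m + lam)) * ⟪e m, 𝔙 (e n)⟫_ℂ := by
        rw [← (U s).symm.inner_map_map, LinearIsometryEquiv.symm_apply_apply, hUs, inner_smul_left,
          ← Complex.exp_conj]
        simp
      rw [this, ← mul_assoc (Complex.exp _), ← Complex.exp_add, ← mul_assoc]
      congr 3
      push_cast; ring
    have hr : (⟪e m, R (e n)⟫_ℂ : ℂ) = (1/2 : ℂ) * (⟪e k, 𝔙 (e 0)⟫_ℂ * (if m = n + k then 1 else 0)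
        + starRingEnd ℂ (⟪e k, 𝔙 (e 0)⟫_ℂ : ℂ) * (if m + k = n then 1 else 0)) := by
      simp only [R, smul_apply, add_apply,
        inner_smul_right, inner_add_right, hSk, hSsk, inner_e_e]
      congr 3
      by_cases h : k ≤ n
      · rw [if_pos h, inner_e_e]
        exact if_congr (by omega) rfl rfl
      · rw [if_neg h, inner_zero_right, if_neg (by omega)]
    rw [smul_apply, inner_smul_right, hl, hr]
    have hpi : (π : ℂ) ≠ 0 := by exact_mod_cast Real.pi_ne_zero
    by_cases h1 : m = n + k
    · rw [if_neg (by omega), if_pos (by omega), if_pos h1, if_neg (by omega),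
        h𝔙top n m 0 k (by omega)]
      push_cast
      field_simp
      ring
    · by_cases h2 : m + k = n
      · rw [if_pos (by omega), if_neg (by omega), if_neg h1, if_pos h2,
          h𝔙top n m k 0 (by omega), inner_conj_symm, h𝔙sa]
        push_cast
        field_simp
        ring
      · rw [if_neg (by omega), if_neg (by omega), if_neg h1, if_neg h2]
        simp
  intro ψ
  have := congrArg (fun T : H2 →L[ℂ] H2 => T ψ) key
  rw [real_smul_H2]
  exact this

end
end

section
/- Let v ∈ ℂ, let k ∈ ℕ with k ≥ 1, and define H₀ := (1/2)(v S^k + conj(v) (S*)^k) on H. For ρ ∈ ℝ and n ≥ 1 set ψ^(n) := n^{−1/2} ∑_{ℓ=0}^{n−1} e^{i ρ ℓ} e_ℓ. Then ‖ψ^(n)‖ = 1 for every n ≥ 1, and there exists a constant C > 0, depending only on k and |v|, such that for every n > k one has ‖(H₀ − Re(v e^{−i ρ k})) ψ^(n)‖ ≤ C n^{−1/2}; in particular (ψ^(n)) is a Weyl sequence for H₀ at the value Re(v e^{−i ρ k}). -/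
/- STATEMENT 5:
H = ℓ²(ℕ,ℂ), S the right shift with adjoint S*.  For v ∈ ℂ, k ≥ 1,
H₀ := (1/2)(v Sᵏ + conj(v)(S*)ᵏ), and for ρ ∈ ℝ, n ≥ 1,
ψ⁽ⁿ⁾ := n^{−1/2} ∑_{ℓ=0}^{n−1} e^{iρℓ} e_ℓ.  Then ‖ψ⁽ⁿ⁾‖ = 1 for n ≥ 1, and there is a
constant C > 0 depending only on k and |v| (in particular uniform in ρ and n) such that
for all n > k, ‖(H₀ − Re(v e^{−iρk})) ψ⁽ⁿ⁾‖ ≤ C n^{−1/2}; so (ψ⁽ⁿ⁾) is a Weyl sequence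
for H₀ at the value Re(v e^{−iρk}). -/

open scoped InnerProductSpace

noncomputable section

/-- The Weyl sequence `ψ⁽ⁿ⁾ = n^{−1/2} ∑_{ℓ=0}^{n−1} e^{iρℓ} e_ℓ`. -/
def weyl (ρ : ℝ) (n : ℕ) : H2 :=
  ((Real.sqrt n : ℂ))⁻¹ • ∑ ℓ ∈ Finset.range n, Complex.exp (Complex.I * ρ * ℓ) • e ℓ

theorem norm_e_eq (n : ℕ) : ‖e n‖ = 1 := by
  unfold e
  rw [lp.norm_single (by norm_num)]
  simp

theorem norm_phase (ρ : ℝ) (l : ℕ) : ‖Complex.exp (Complex.I * ρ * l)‖ = 1 := by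
  rw [Complex.norm_exp]
  simp

theorem orthonormal_e : Orthonormal ℂ e := by
  rw [orthonormal_iff_ite]
  intro i j
  unfold e
  rw [lp.inner_single_left]
  by_cases h : i = j
  · subst h
    simp
  · simp [h, lp.single_apply_ne]

theorem norm_phase_sum_sq (ρ : ℝ) (n : ℕ) :
    ‖∑ l ∈ Finset.range n, Complex.exp (Complex.I * ρ * l) • e l‖ ^ 2 = n := by
  have h := orthonormal_e.inner_sum (fun l : ℕ => Complex.exp (Complex.I * ρ * l))
    (fun l : ℕ => Complex.exp (Complex.I * ρ * l)) (Finset.range n)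
  have h2 : ∀ l : ℕ, (starRingEnd ℂ) (Complex.exp (Complex.I * ρ * l)) *
      Complex.exp (Complex.I * ρ * l) = 1 := by
    intro l
    rw [Complex.conj_mul', norm_phase]
    simp
  rw [inner_self_eq_norm_sq_to_K] at h
  simp only [h2] at h
  simp only [Finset.sum_const, Finset.card_range, nsmul_eq_mul, mul_one] at h
  have h3 := congrArg Complex.re h
  rw [← RCLike.ofReal_pow] at h3
  simpa only [Complex.coe_algebraMap, RCLike.ofReal_eq_complex_ofReal, Complex.ofReal_re, Complex.natCast_re] using h3

theorem norm_weyl (ρ : ℝ) (n : ℕ) (hn : 1 ≤ n) : ‖weyl ρ n‖ = 1 := by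
  unfold weyl
  have h := norm_phase_sum_sq ρ n
  have hs : 0 < Real.sqrt n := Real.sqrt_pos.mpr (by exact_mod_cast hn)
  have h' : ‖∑ l ∈ Finset.range n, Complex.exp (Complex.I * ρ * l) • e l‖ = Real.sqrt n := by
    rw [← h, Real.sqrt_sq (norm_nonneg _)]
  rw [norm_smul, h', norm_inv, Complex.norm_real, Real.norm_eq_abs, abs_of_pos hs,
    inv_mul_cancel₀ hs.ne']

theorem norm_block_le (ρ : ℝ) (k : ℕ) (a : ℕ → ℕ) (b : ℕ → ℕ) :
    ‖∑ i ∈ Finset.range k, Complex.exp (Complex.I * ρ * (a i : ℕ)) • e (b i)‖ ≤ k := by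
  refine (norm_sum_le _ _).trans ?_
  simp [norm_smul, norm_phase, norm_e_eq]

theorem pow_shift (S : H2 →L[ℂ] H2) (hS : ∀ n : ℕ, S (e n) = e (n + 1)) (k n : ℕ) :
    (S ^ k) (e n) = e (k + n) := by
  induction k generalizing n with
  | zero => simp
  | succ k ih =>
    rw [pow_succ, mul_apply_eq_comp, hS, ih]
    congr 1
    ring

theorem pow_back (T : H2 →L[ℂ] H2) (hT : ∀ n : ℕ, T (e (n + 1)) = e n) (k n : ℕ) :
    (T ^ k) (e (k + n)) = e n := by
  induction k generalizing n with
  | zero => simp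
  | succ k ih =>
    rw [pow_succ, mul_apply_eq_comp, show k + 1 + n = (k + n) + 1 by ring, hT, ih]

theorem pow_back_zero (T : H2 →L[ℂ] H2) (h0 : T (e 0) = 0)
    (hT : ∀ n : ℕ, T (e (n + 1)) = e n) (k n : ℕ) (h : n < k) :
    (T ^ k) (e n) = 0 := by
  induction k generalizing n with
  | zero => omega
  | succ k ih =>
    rw [pow_succ, mul_apply_eq_comp]
    cases n with
    | zero => rw [h0, map_zero]
    | succ n => rw [hT, ih n (by omega)]

theorem phase_add (ρ : ℝ) (k l : ℕ) : Complex.exp (Complex.I * ρ * ((k + l : ℕ) : ℂ)) =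
    Complex.exp (Complex.I * ρ * k) * Complex.exp (Complex.I * ρ * l) := by
  rw [← Complex.exp_add]
  congr 1
  push_cast
  ring

theorem phase_cancel (ρ : ℝ) (k : ℕ) :
    Complex.exp (-Complex.I * ρ * k) * Complex.exp (Complex.I * ρ * k) = 1 := by
  rw [← Complex.exp_add]
  simp

theorem forward_bound (S : H2 →L[ℂ] H2) (hS : ∀ n : ℕ, S (e n) = e (n + 1))
    (ρ : ℝ) (k n : ℕ) :
    ‖(S ^ k) (∑ l ∈ Finset.range n, Complex.exp (Complex.I * ρ * l) • e l)
      - Complex.exp (-Complex.I * ρ * k) •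
        ∑ l ∈ Finset.range n, Complex.exp (Complex.I * ρ * l) • e l‖ ≤ 2 * k := by
  have h1 : (S ^ k) (∑ l ∈ Finset.range n, Complex.exp (Complex.I * ρ * l) • e l) =
      Complex.exp (-Complex.I * ρ * k) •
        ∑ l ∈ Finset.range n, Complex.exp (Complex.I * ρ * ((k + l : ℕ) : ℂ)) • e (k + l) := by
    rw [map_sum, Finset.smul_sum]
    refine Finset.sum_congr rfl fun l _ => ?_
    rw [map_smul, pow_shift S hS, smul_smul, phase_add, ← mul_assoc, phase_cancel, one_mul]
  have h2 := Finset.sum_range_add (fun l : ℕ => Complex.exp (Complex.I * ρ * l) • e l) k n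
  have h3 := Finset.sum_range_add (fun l : ℕ => Complex.exp (Complex.I * ρ * l) • e l) n k
  rw [add_comm n k, h2] at h3
  have hc : ‖Complex.exp (-Complex.I * ρ * k)‖ = 1 := by
    rw [Complex.norm_exp]
    simp
  rw [h1, ← smul_sub, norm_smul, hc, one_mul]
  have h4 : (∑ l ∈ Finset.range n, Complex.exp (Complex.I * ρ * ((k + l : ℕ) : ℂ)) • e (k + l))
      - ∑ l ∈ Finset.range n, Complex.exp (Complex.I * ρ * l) • e l =
      (∑ l ∈ Finset.range k, Complex.exp (Complex.I * ρ * ((n + l : ℕ) : ℂ)) • e (n + l))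
      - ∑ l ∈ Finset.range k, Complex.exp (Complex.I * ρ * l) • e l := by
    rw [sub_eq_sub_iff_add_eq_add, add_comm, h3, add_comm]
  rw [h4]
  refine (norm_sub_le _ _).trans ?_
  have := norm_block_le ρ k (fun i => n + i) (fun i => n + i)
  have := norm_block_le ρ k (fun i => i) (fun i => i)
  linarith

theorem backward_bound (T : H2 →L[ℂ] H2) (h0 : T (e 0) = 0)
    (hT : ∀ n : ℕ, T (e (n + 1)) = e n) (ρ : ℝ) (k n : ℕ) (hkn : k ≤ n) :
    ‖(T ^ k) (∑ l ∈ Finset.range n, Complex.exp (Complex.I * ρ * l) • e l)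
      - Complex.exp (Complex.I * ρ * k) •
        ∑ l ∈ Finset.range n, Complex.exp (Complex.I * ρ * l) • e l‖ ≤ k := by
  obtain ⟨m, rfl⟩ := Nat.exists_eq_add_of_le hkn
  have h1 : (T ^ k) (∑ l ∈ Finset.range (k + m), Complex.exp (Complex.I * ρ * l) • e l) =
      Complex.exp (Complex.I * ρ * k) •
        ∑ l ∈ Finset.range m, Complex.exp (Complex.I * ρ * l) • e l := by
    rw [Finset.sum_range_add, map_add, map_sum, map_sum, Finset.smul_sum,
      Finset.sum_eq_zero, zero_add]
    · refine Finset.sum_congr rfl fun l _ => ?_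
      rw [map_smul, pow_back T hT, smul_smul, phase_add]
    · intro l hl
      rw [map_smul, pow_back_zero T h0 hT k l (Finset.mem_range.mp hl), smul_zero]
  rw [h1, ← smul_sub, norm_smul, norm_phase, one_mul, add_comm k m, Finset.sum_range_add,
    sub_add_cancel_left, norm_neg]
  exact norm_block_le ρ k (fun i => m + i) (fun i => m + i)

theorem re_symbol (v : ℂ) (ρ : ℝ) (k : ℕ) :
    (((v * Complex.exp (-Complex.I * ρ * k)).re : ℂ)) =
      (1 / 2 : ℂ) * (v * Complex.exp (-Complex.I * ρ * k)
        + (starRingEnd ℂ v) * Complex.exp (Complex.I * ρ * k)) := by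
  rw [Complex.re_eq_add_conj, map_mul, ← Complex.exp_conj]
  simp only [map_mul, map_neg, Complex.conj_I, Complex.conj_ofReal, Complex.conj_natCast, neg_neg]
  ring

theorem stmt5
    (S Sstar : H2 →L[ℂ] H2)
    (hS : ∀ n : ℕ, S (e n) = e (n + 1))
    (hSstar0 : Sstar (e 0) = 0)
    (hSstar : ∀ n : ℕ, Sstar (e (n + 1)) = e n)
    (v : ℂ) (k : ℕ) (hk : 1 ≤ k) :
    (∀ (ρ : ℝ) (n : ℕ), 1 ≤ n → ‖weyl ρ n‖ = 1) ∧
    (∃ C : ℝ, 0 < C ∧ ∀ (ρ : ℝ) (n : ℕ), k < n →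
      ‖((1 / 2 : ℂ) • (v • (S ^ k) + (starRingEnd ℂ v) • (Sstar ^ k))) (weyl ρ n)
          - (((v * Complex.exp (-Complex.I * ρ * k)).re : ℂ)) • weyl ρ n‖
        ≤ C / Real.sqrt n) := by
  refine ⟨norm_weyl, 2 * k * ‖v‖ + 1, by positivity, ?_⟩
  intro ρ n hn
  have hf := forward_bound S hS ρ k n
  have hb := backward_bound Sstar hSstar0 hSstar ρ k n hn.le
  rw [re_symbol]
  unfold weyl
  set P := ∑ l ∈ Finset.range n, Complex.exp (Complex.I * ρ * l) • e l with hP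
  set a := Complex.exp (-Complex.I * ρ * k)
  set b := Complex.exp (Complex.I * ρ * k)
  have key : ((1 / 2 : ℂ) • (v • (S ^ k) + (starRingEnd ℂ v) • (Sstar ^ k)))
        (((Real.sqrt n : ℂ))⁻¹ • P)
      - ((1 / 2 : ℂ) * (v * a + (starRingEnd ℂ v) * b)) • ((Real.sqrt n : ℂ))⁻¹ • P
      = ((Real.sqrt n : ℂ))⁻¹ • (1 / 2 : ℂ) •
        (v • ((S ^ k) P - a • P) + (starRingEnd ℂ v) • ((Sstar ^ k) P - b • P)) := by
    simp only [ContinuousLinearMap.smul_apply, ContinuousLinearMap.add_apply, map_smul]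
    module
  rw [key, norm_smul, norm_inv, Complex.norm_real, Real.norm_eq_abs,
    abs_of_nonneg (Real.sqrt_nonneg _), div_eq_inv_mul _ (Real.sqrt n)]
  refine mul_le_mul_of_nonneg_left ?_ (inv_nonneg.mpr (Real.sqrt_nonneg _))
  have h12 : ‖(1 / 2 : ℂ)‖ = 1 / 2 := by simp
  rw [norm_smul, h12]
  have hadd := norm_add_le (v • ((S ^ k) P - a • P))
    ((starRingEnd ℂ v) • ((Sstar ^ k) P - b • P))
  rw [norm_smul, norm_smul, RCLike.norm_conj] at hadd
  have m1 := mul_le_mul_of_nonneg_left hf (norm_nonneg v)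
  have m2 := mul_le_mul_of_nonneg_left hb (norm_nonneg v)
  have hvk : 0 ≤ ‖v‖ * k := by positivity
  nlinarith

end
end

section
/- Let g : ℝ → ℝ be a smooth compactly supported function and let 𝓗 be a complex Hilbert space. Then there exists a constant C > 0, depending only on g, such that for all bounded selfadjoint operators H and B on 𝓗 one has ‖g(H + B) − g(H)‖ ≤ C ‖B‖. -/
open MeasureTheory Complex in
theorem exp_unitary_aux {A : Type*} [CStarAlgebra A] (a : A) (ha : IsSelfAdjoint a) (u : ℝ) :
    NormedSpace.exp (u • (I • a)) ∈ unitary A := by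
  have h := (selfAdjoint.expUnitary (⟨u • a, (IsSelfAdjoint.all u).smul ha⟩ : selfAdjoint A)).2
  rw [selfAdjoint.expUnitary_coe] at h
  rwa [smul_comm]

open MeasureTheory Complex in
theorem exp_lip_aux {A : Type*} [CStarAlgebra A] (a b : A) (ha : IsSelfAdjoint a)
    (hb : IsSelfAdjoint b) :
    ‖NormedSpace.exp (I • a) - NormedSpace.exp (I • b)‖ ≤ ‖a - b‖ := by
  have hd : ∀ x : ℝ, HasDerivAt
      (fun u : ℝ => NormedSpace.exp (u • (I • a)) * NormedSpace.exp ((1 - u) • (I • b)))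
      (NormedSpace.exp (x • (I • a)) * (I • (a - b)) * NormedSpace.exp ((1 - x) • (I • b))) x := by
    intro x
    have h1 := hasDerivAt_exp_smul_const (𝕂 := ℝ) (I • a) x
    have h2 := hasDerivAt_exp_smul_const' (𝕂 := ℝ) (I • b) (1 - x)
    have h3 : HasDerivAt (fun u : ℝ => 1 - u) (-1) x := by
      simpa using (hasDerivAt_id x).const_sub 1
    have h4 := h2.scomp x h3
    have h5 := h1.mul h4
    refine h5.congr_deriv ?_
    simp only [Function.comp, neg_smul, one_smul, smul_sub, mul_sub, sub_mul, mul_neg, mul_assoc]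
    exact (sub_eq_add_neg _ _).symm
  have key := norm_image_sub_le_of_norm_deriv_le_segment_01' (C := ‖a - b‖)
    (fun x _ => (hd x).hasDerivWithinAt) (fun x _ => by
      have e1 := CStarRing.norm_mul_coe_unitary
        (NormedSpace.exp (x • (I • a)) * (I • (a - b))) ⟨_, exp_unitary_aux b hb (1 - x)⟩
      have e2 := CStarRing.norm_coe_unitary_mul
        ⟨_, exp_unitary_aux a ha x⟩ (I • (a - b))
      simp only at e1 e2
      rw [e1, e2, norm_smul]
      simp)
  simpa using key

open MeasureTheory Complex in
theorem cfc_exp_aux {A : Type*} [CStarAlgebra A] (a : A) (ha : IsSelfAdjoint a) (t : ℝ) (c : ℂ) :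
    cfc (fun z : ℂ => c * cexp (2 * Real.pi * t * z.re * I)) a
      = c • NormedSpace.exp (I • ((2 * Real.pi * t) • a)) := by
  have hn : IsStarNormal a := ha.isStarNormal
  have h1 : cfc (fun z : ℂ => c * cexp (2 * Real.pi * t * z.re * I)) a
      = cfc (fun z : ℂ => c * cexp ((I * (2 * Real.pi * t)) * z)) a := by
    refine cfc_congr fun z hz => ?_
    have hz' : ((z.re : ℝ) : ℂ) = z :=
      (SpectrumRestricts.real_iff.mp ha.spectrumRestricts z hz).symm
    simp only [hz']
    ring_nf
  have hn2 : IsStarNormal ((I * (2 * Real.pi * t)) • a) := by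
    constructor
    rw [star_smul]
    exact (hn.star_comm_self.smul_left _).smul_right _
  rw [h1, cfc_const_mul _ _ a, cfc_comp_const_mul (I * (2 * Real.pi * t)) cexp a,
    CFC.complex_exp_eq_normedSpace_exp hn2]
  congr 2
  rw [← smul_smul]
  congr 1
  rw [← Complex.coe_smul]
  push_cast
  rfl

open Complex in
theorem diff_aux {A : Type*} [CStarAlgebra A] (H B : A) (hH : IsSelfAdjoint H)
    (hB : IsSelfAdjoint B) (t : ℝ) (c : ℂ) :
    ‖c • NormedSpace.exp (I • ((2 * Real.pi * t) • (H + B)))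
      - c • NormedSpace.exp (I • ((2 * Real.pi * t) • H))‖
      ≤ (2 * Real.pi * ‖B‖) * (‖t‖ * ‖c‖) := by
  rw [← smul_sub, norm_smul]
  have := exp_lip_aux ((2 * Real.pi * t) • (H + B)) ((2 * Real.pi * t) • H)
    ((IsSelfAdjoint.all _).smul (hH.add hB)) ((IsSelfAdjoint.all _).smul hH)
  rw [← smul_sub, add_sub_cancel_left, norm_smul] at this
  have h2 : ‖2 * Real.pi * t‖ = 2 * Real.pi * ‖t‖ := by
    simp [abs_of_pos Real.pi_pos]
  rw [h2] at this
  calc _ ≤ ‖c‖ * (2 * Real.pi * ‖t‖ * ‖B‖) := by gcongr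
    _ = _ := by ring

open MeasureTheory Complex FourierTransform in
theorem stmt7 (g : ℝ → ℝ) (hg : ContDiff ℝ (⊤ : ℕ∞) g) (hgsupp : HasCompactSupport g)
    {𝓗 : Type*} [NormedAddCommGroup 𝓗] [InnerProductSpace ℂ 𝓗] [CompleteSpace 𝓗] :
    ∃ C : ℝ, 0 < C ∧ ∀ H B : 𝓗 →L[ℂ] 𝓗, IsSelfAdjoint H → IsSelfAdjoint B →
      ‖cfc g (H + B) - cfc g H‖ ≤ C * ‖B‖ := by
  have hGs : HasCompactSupport (fun x => (g x : ℂ)) := hgsupp.comp_left (g := ((↑) : ℝ → ℂ)) (by simp)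
  have hGc : ContDiff ℝ (⊤ : ℕ∞) (fun x => (g x : ℂ)) := Complex.ofRealCLM.contDiff.comp hg
  let G : SchwartzMap ℝ ℂ := hGs.toSchwartzMap hGc
  let F : SchwartzMap ℝ ℂ := 𝓕 G
  have hFint : Integrable F := F.integrable
  have hF1 : Integrable (fun t : ℝ => ‖t‖ * ‖F t‖) := by simpa using F.integrable_pow_mul volume 1
  have hinv : ∀ x : ℝ, (g x : ℂ) = ∫ t : ℝ, F t * cexp (2 * Real.pi * t * x * I) := by
    intro x
    have h1 : (𝓕⁻ F : SchwartzMap ℝ ℂ) x = g x := by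
      rw [show (𝓕⁻ F : SchwartzMap ℝ ℂ) = G from FourierTransform.fourierInv_fourier_eq G]
      rfl
    rw [← h1, SchwartzMap.fourierInv_coe, Real.fourierInv_eq']
    refine integral_congr_ae (.of_forall fun t => ?_)
    simp only [smul_eq_mul]
    rw [mul_comm]
    congr 2
    simp
    ring
  have hrep : ∀ a : 𝓗 →L[ℂ] 𝓗, IsSelfAdjoint a →
      Integrable (fun t : ℝ => F t • NormedSpace.exp (I • ((2 * Real.pi * t) • a))) ∧
      cfc g a = ∫ t : ℝ, F t • NormedSpace.exp (I • ((2 * Real.pi * t) • a)) := by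
    intro a ha
    have hn : IsStarNormal a := ha.isStarNormal
    have hc : Continuous (Function.uncurry
        (fun (t : ℝ) (z : ℂ) => F t * cexp (2 * Real.pi * t * z.re * I))) := by
      have := F.continuous
      unfold Function.uncurry
      fun_prop
    have hb : ∀ᵐ t : ℝ, ∀ z ∈ spectrum ℂ a,
        ‖F t * cexp (2 * Real.pi * t * z.re * I)‖ ≤ ‖F t‖ := .of_forall fun t z _ => by
      have : ‖cexp (2 * Real.pi * t * z.re * I)‖ = 1 := by
        have := Complex.norm_exp_ofReal_mul_I (2 * Real.pi * t * z.re)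
        push_cast at this
        exact this
      rw [norm_mul, this, mul_one]
    constructor
    · have := integrable_cfc (fun (t : ℝ) (z : ℂ) => F t * cexp (2 * Real.pi * t * z.re * I))
        (fun t => ‖F t‖) a hc.continuousOn hb hFint.norm.2
      simpa only [cfc_exp_aux a ha] using this
    · have := cfc_integral (fun (t : ℝ) (z : ℂ) => F t * cexp (2 * Real.pi * t * z.re * I))
        (fun t => ‖F t‖) a hc.continuousOn hb hFint.norm.2
      rw [cfc_real_eq_complex g ha]
      simp only [hinv]
      rw [this]
      simp only [cfc_exp_aux a ha]
  refine ⟨2 * Real.pi * (∫ t : ℝ, ‖t‖ * ‖F t‖) + 1, ?_, ?_⟩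
  · have : 0 ≤ ∫ t : ℝ, ‖t‖ * ‖F t‖ := integral_nonneg fun t => by positivity
    positivity
  intro H B hH hB
  obtain ⟨i1, e1⟩ := hrep (H + B) (hH.add hB)
  obtain ⟨i2, e2⟩ := hrep H hH
  rw [e1, e2, ← integral_sub i1 i2]
  calc _ ≤ ∫ t : ℝ, (2 * Real.pi * ‖B‖) * (‖t‖ * ‖F t‖) := by
        refine norm_integral_le_of_norm_le (hF1.const_mul _) (.of_forall fun t => ?_)
        exact diff_aux H B hH hB t (F t)
    _ = 2 * Real.pi * (∫ t : ℝ, ‖t‖ * ‖F t‖) * ‖B‖ := by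
        rw [integral_const_mul]; ring
    _ ≤ _ := by
        have := norm_nonneg B
        linarith
end

section
/- Let g : ℝ → ℝ be a smooth compactly supported function, and let H and B be bounded selfadjoint operators on a complex Hilbert space 𝓗 with B compact. Then the operator g(H + B) − g(H) is compact. -/
/- STATEMENT 8:
Let g : ℝ → ℝ be smooth and compactly supported, and H, B bounded selfadjoint operators
on a complex Hilbert space 𝓗 with B compact.  Then g(H + B) − g(H) is compact.
Here g(H) is defined by the continuous functional calculus (`cfc`). -/

theorem stmt8_poly {𝓗 : Type*} [NormedAddCommGroup 𝓗] [InnerProductSpace ℂ 𝓗] [CompleteSpace 𝓗]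
    (H B : 𝓗 →L[ℂ] 𝓗) (hB : IsCompactOperator ⇑B) (p : Polynomial ℝ) :
    IsCompactOperator ⇑(Polynomial.aeval (H + B) p - Polynomial.aeval H p) := by
  induction p using Polynomial.induction_on with
  | C a => simpa using isCompactOperator_zero
  | add p q hp hq =>
    have h : Polynomial.aeval (H + B) (p + q) - Polynomial.aeval H (p + q)
      = (Polynomial.aeval (H + B) p - Polynomial.aeval H p) +
        (Polynomial.aeval (H + B) q - Polynomial.aeval H q) := by
      simp only [map_add]; abel
    rw [h]
    exact hp.add hq
  | monomial n a ih =>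
    have h : Polynomial.aeval (H + B) (Polynomial.C a * Polynomial.X ^ (n + 1))
        - Polynomial.aeval H (Polynomial.C a * Polynomial.X ^ (n + 1))
      = (Polynomial.aeval (H + B) (Polynomial.C a * Polynomial.X ^ n)
        - Polynomial.aeval H (Polynomial.C a * Polynomial.X ^ n)) * (H + B) +
        Polynomial.aeval H (Polynomial.C a * Polynomial.X ^ n) * B := by
      rw [pow_succ, ← mul_assoc]
      generalize Polynomial.C a * Polynomial.X ^ n = q
      simp only [map_mul, Polynomial.aeval_X]
      noncomm_ring
    rw [h]
    exact (ih.comp_clm (H + B)).add (hB.clm_comp _)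

theorem stmt8 (g : ℝ → ℝ) (hg : ContDiff ℝ (⊤ : ℕ∞) g) (hgsupp : HasCompactSupport g)
    {𝓗 : Type*} [NormedAddCommGroup 𝓗] [InnerProductSpace ℂ 𝓗] [CompleteSpace 𝓗]
    (H B : 𝓗 →L[ℂ] 𝓗) (hH : IsSelfAdjoint H) (hB : IsSelfAdjoint B)
    (hBcompact : IsCompactOperator ⇑B) :
    IsCompactOperator ⇑(cfc g (H + B) - cfc g H) := by
  have hgc : Continuous g := hg.continuous
  have hHB : IsSelfAdjoint (H + B) := hH.add hB
  have hcl : IsClosed {f : 𝓗 →L[ℂ] 𝓗 | IsCompactOperator ⇑f} :=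
    isClosed_setOfPred_isCompactOperator
  suffices h : (cfc g (H + B) - cfc g H) ∈ closure {f : 𝓗 →L[ℂ] 𝓗 | IsCompactOperator ⇑f} by
    rw [hcl.closure_eq] at h
    exact h
  rw [Metric.mem_closure_iff]
  intro ε hε
  let R := max (‖H + B‖ * ‖(1 : 𝓗 →L[ℂ] 𝓗)‖) (‖H‖ * ‖(1 : 𝓗 →L[ℂ] 𝓗)‖)
  obtain ⟨p, hp⟩ := exists_polynomial_near_of_continuousOn (-R) R g hgc.continuousOn (ε / 3)
    (by positivity)
  have key : ∀ T : 𝓗 →L[ℂ] 𝓗, IsSelfAdjoint T → ‖T‖ * ‖(1 : 𝓗 →L[ℂ] 𝓗)‖ ≤ R →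
      ‖cfc g T - Polynomial.aeval T p‖ ≤ ε / 3 := by
    intro T hT hTR
    rw [← cfc_polynomial p T hT, ← cfc_sub g p.eval T hgc.continuousOn p.continuous.continuousOn]
    refine norm_cfc_le (by positivity) fun x hx => ?_
    have hx' := (spectrum.norm_le_norm_mul_of_mem hx).trans hTR
    rw [Real.norm_eq_abs, abs_le] at hx'
    have := hp x hx'
    rw [Real.norm_eq_abs, abs_sub_comm]
    exact this.le
  refine ⟨_, stmt8_poly H B hBcompact p, ?_⟩
  have h1 := key (H + B) hHB (le_max_left _ _)
  have h2 := key H hH (le_max_right _ _)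
  rw [dist_eq_norm, sub_sub_sub_comm]
  have := norm_sub_le (cfc g (H + B) - Polynomial.aeval (H + B) p)
    (cfc g H - Polynomial.aeval H p)
  linarith
end
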